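/- Let N > 1 and B be positive integers, let S = {a_1,…,a_{3N}} be a multiset of positive integers with B/4 < a_i < B/2 for all i and Σ_{i=1}^{3N} a_i = N·B, and let τ > 0. Construct planar geometric graphs G and H in ℝ² placed side-by-side inside a bounding box of width x = τ/(2·C_V·(N+1)·N·B) and height L = τ/(2·C_E·(N+1)) as follows: G consists of 3N pairwise disjoint blobs G_1,…,G_{3N} of sizes a_1,…,a_{3N}, and H consists of N pairwise disjoint blobs H_1,…,H_N each of size B, where a blob of size k consists of k vertices u_1,…,u_k on an upper horizontal row and k vertices l_1,…,l_k on a lower horizontal row at vertical distance L, with each u_j for j ≥ 2 joined by edges to l_{j−1} and l_j, and u_1 joined to l_1, all vertical edges having length L (with equal slanted-edge lengths, blobs non-overlapping, all fitting in the box). Then S admits a partition into N triples each summing to B if and only if GGD(G,H) ≤ τ. -/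

import Mathlib

open scoped Classical
noncomputable section

/-- Points of the ambient Euclidean space `ℝ^d`. -/
abbrev Pt (d : ℕ) := EuclideanSpace ℝ (Fin d)

/-- A combinatorial graph embedded in `ℝ^d`: a finite vertex set of points together with a
finite set of (oriented representatives of) straight-line edges, recorded as pairs of points. -/
structure EGraph (d : ℕ) where
  verts : Finset (Pt d)
  edges : Finset (Pt d × Pt d)

/-- A geometric graph of `ℝ^d`: the straight-line segments realizing the edges intersect
(possibly) only at shared endpoints. -/
structure GeoGraph (d : ℕ) extends EGraph d where
  edge_fst_mem : ∀ e ∈ edges, e.1 ∈ verts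
  edge_snd_mem : ∀ e ∈ edges, e.2 ∈ verts
  edge_ne : ∀ e ∈ edges, e.1 ≠ e.2
  segments_meet_at_endpoints : ∀ e ∈ edges, ∀ f ∈ edges, e ≠ f →
    ∀ p ∈ segment ℝ e.1 e.2 ∩ segment ℝ f.1 f.2,
      (p = e.1 ∨ p = e.2) ∧ (p = f.1 ∨ p = f.2)

/-- `Vol G`: the total edge length of `G`. -/
def EGraph.vol {d : ℕ} (G : EGraph d) : ℝ := ∑ e ∈ G.edges, dist e.1 e.2

/-- The degree of a vertex `u`: the number of edges incident to `u`. -/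
def EGraph.degree {d : ℕ} (G : EGraph d) (u : Pt d) : ℕ :=
  (G.edges.filter (fun e => e.1 = u ∨ e.2 = u)).card

/-- The maximum vertex degree of a graph. -/
def EGraph.maxDegree {d : ℕ} (G : EGraph d) : ℕ := G.verts.sup G.degree

/-- A graph has no isolated vertex when every vertex has an incident edge. -/
def NoIsolated {d : ℕ} (G : EGraph d) : Prop :=
  ∀ u ∈ G.verts, ∃ e ∈ G.edges, e.1 = u ∨ e.2 = u

/-- A state during an editing process: an abstract (labelled) combinatorial graph together
with an embedding of its vertices into `ℝ^d`.  Intermediate states need not be geometric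
graphs (positions may even coincide). -/
structure EState (d : ℕ) where
  verts : Finset ℕ
  pos : ℕ → Pt d
  edges : Finset (ℕ × ℕ)

/-- A state represents a geometric graph when its embedded image is exactly that graph. -/
def EState.Represents {d : ℕ} (S : EState d) (G : EGraph d) : Prop :=
  Set.InjOn S.pos ↑S.verts ∧
  S.verts.image S.pos = G.verts ∧
  (∀ e ∈ S.edges, e.1 ∈ S.verts ∧ e.2 ∈ S.verts) ∧
  S.edges.image (fun e => (S.pos e.1, S.pos e.2)) = G.edges

/-- The elementary edit operations. -/
inductive EditOp (d : ℕ) where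
  | delVert (i : ℕ)
  | insVert (i : ℕ) (p : Pt d)
  | delEdge (i j : ℕ)
  | insEdge (i j : ℕ)
  | moveVert (i : ℕ) (p : Pt d)

namespace EditOp

/-- The effect of an edit operation on a state. -/
def apply {d : ℕ} (S : EState d) : EditOp d → EState d
  | delVert i => ⟨S.verts.erase i, S.pos, S.edges⟩
  | insVert i p => ⟨insert i S.verts, Function.update S.pos i p, S.edges⟩
  | delEdge i j => ⟨S.verts, S.pos, S.edges.erase (i, j)⟩
  | insEdge i j => ⟨S.verts, S.pos, insert (i, j) S.edges⟩
  | moveVert i p => ⟨S.verts, Function.update S.pos i p, S.edges⟩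

/-- Legality of an edit operation on a state: only isolated existing vertices may be deleted,
inserted vertices are new, deleted edges exist, and inserted edges join existing vertices. -/
def legal {d : ℕ} (S : EState d) : EditOp d → Prop
  | delVert i => i ∈ S.verts ∧ ∀ e ∈ S.edges, e.1 ≠ i ∧ e.2 ≠ i
  | insVert i _ => i ∉ S.verts
  | delEdge i j => (i, j) ∈ S.edges
  | insEdge i j => i ∈ S.verts ∧ j ∈ S.verts ∧ (i, j) ∉ S.edges
  | moveVert i _ => i ∈ S.verts

/-- The cost of an edit operation: vertex insertion/deletion is free, edge insertion/deletion
costs `C_E` times the edge length, and translating a vertex costs `C_V` times the displacement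
plus `C_E` times the total change in length of all incident edges. -/
def cost {d : ℕ} (CV CE : ℝ) (S : EState d) : EditOp d → ℝ
  | delVert _ => 0
  | insVert _ _ => 0
  | delEdge i j => CE * dist (S.pos i) (S.pos j)
  | insEdge i j => CE * dist (S.pos i) (S.pos j)
  | moveVert i p => CV * dist (S.pos i) p +
      ∑ e ∈ S.edges,
        CE * |dist (Function.update S.pos i p e.1) (Function.update S.pos i p e.2)
                - dist (S.pos e.1) (S.pos e.2)|

/-- The inverse of an edit operation (relative to the state it is applied to). -/
def inv {d : ℕ} (S : EState d) : EditOp d → EditOp d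
  | delVert i => insVert i (S.pos i)
  | insVert i _ => delVert i
  | delEdge i j => insEdge i j
  | insEdge i j => delEdge i j
  | moveVert i _ => moveVert i (S.pos i)

end EditOp

/-- Applying a sequence of edit operations. -/
def applyPath {d : ℕ} (S : EState d) (P : List (EditOp d)) : EState d :=
  P.foldl EditOp.apply S

/-- Every operation of the sequence is legal on the intermediate result it is applied to. -/
def legalPath {d : ℕ} : EState d → List (EditOp d) → Prop
  | _, [] => True
  | S, o :: P => EditOp.legal S o ∧ legalPath (EditOp.apply S o) P

/-- The cost of an edit path: the sum of the costs of its individual edits. -/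
def pathCost {d : ℕ} (CV CE : ℝ) : EState d → List (EditOp d) → ℝ
  | _, [] => 0
  | S, o :: P => EditOp.cost CV CE S o + pathCost CV CE (EditOp.apply S o) P

/-- The inverse edit path: the reversed sequence of the inverse operations. -/
def invPath {d : ℕ} : EState d → List (EditOp d) → List (EditOp d)
  | _, [] => []
  | S, o :: P => invPath (EditOp.apply S o) P ++ [EditOp.inv S o]

/-- `P` is an edit path from `G` to `H`, starting at the representing state `S`. -/
def IsEditPathFrom {d : ℕ} (G H : EGraph d) (S : EState d) (P : List (EditOp d)) : Prop :=
  S.Represents G ∧ legalPath S P ∧ (applyPath S P).Represents H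

/-- The geometric edit distance: the infimum cost of an edit path from `G` to `H`. -/
def GED {d : ℕ} (CV CE : ℝ) (G H : GeoGraph d) : ℝ :=
  sInf {c : ℝ | ∃ (S : EState d) (P : List (EditOp d)),
    IsEditPathFrom G.toEGraph H.toEGraph S P ∧ pathCost CV CE S P = c}

/-- Distance between possibly-dummy vertices: `|a − ε_V| = 0`. -/
def odist {d : ℕ} : Option (Pt d) → Option (Pt d) → ℝ
  | some a, some b => dist a b
  | _, _ => 0

/-- Length of a possibly-dummy edge: `|ε_E| = 0`. -/
def elen {d : ℕ} : Option (Pt d × Pt d) → ℝ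
  | some e => dist e.1 e.2
  | none => 0

/-- One step of the evolution of the vertex with label `i` under an edit operation;
a deleted vertex is recorded as the dummy vertex `none` and stays dummy. -/
def vStep {d : ℕ} (i : ℕ) (o : EditOp d) (s : Option (Pt d)) : Option (Pt d) :=
  match s, o with
  | none, _ => none
  | some _, .delVert j => if j = i then none else s
  | some _, .moveVert j p => if j = i then some p else s
  | some _, _ => s

/-- The end result `P(u)` of the evolution of the vertex with label `i` under the path `P`. -/
def vTrack {d : ℕ} (i : ℕ) (P : List (EditOp d)) (s : Option (Pt d)) : Option (Pt d) :=
  P.foldl (fun s o => vStep i o s) s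

/-- The cost of the orbit of the vertex with label `i`:
`C_V` times the total displacement along the orbit. -/
def vOrbitCost {d : ℕ} (CV : ℝ) (i : ℕ) : Option (Pt d) → List (EditOp d) → ℝ
  | _, [] => 0
  | s, o :: P => CV * odist s (vStep i o s) + vOrbitCost CV i (vStep i o s) P

/-- One step of the evolution of the edge with label pair `(i, j)` under an edit operation;
a deleted edge (or an edge losing an endpoint) is recorded as the dummy edge `none`. -/
def eStep {d : ℕ} (i j : ℕ) (o : EditOp d) (s : Option (Pt d × Pt d)) :
    Option (Pt d × Pt d) :=
  match s, o with
  | none, _ => none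
  | some _, .delEdge a b => if a = i ∧ b = j then none else s
  | some _, .delVert a => if a = i ∨ a = j then none else s
  | some q, .moveVert a p =>
      if a = i then some (p, q.2) else if a = j then some (q.1, p) else s
  | some _, _ => s

/-- The end result `P(e)` of the evolution of the edge with label pair `(i, j)` under `P`. -/
def eTrack {d : ℕ} (i j : ℕ) (P : List (EditOp d)) (s : Option (Pt d × Pt d)) :
    Option (Pt d × Pt d) :=
  P.foldl (fun s o => eStep i j o s) s

/-- The cost of the orbit of the edge with label pair `(i, j)`:
`C_E` times the total variation of its length along the orbit. -/
def eOrbitCost {d : ℕ} (CE : ℝ) (i j : ℕ) : Option (Pt d × Pt d) → List (EditOp d) → ℝ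
  | _, [] => 0
  | s, o :: P => CE * |elen (eStep i j o s) - elen s| + eOrbitCost CE i j (eStep i j o s) P

/-- An inexact matching between `G` and `H`: every vertex of `G` is matched with exactly one
vertex of `H` or with the dummy vertex (`none`), and conversely, consistently. -/
structure Matching (d : ℕ) (G H : EGraph d) where
  f : Pt d → Option (Pt d)
  g : Pt d → Option (Pt d)
  f_mem : ∀ u ∈ G.verts, ∀ v, f u = some v → v ∈ H.verts
  g_mem : ∀ v ∈ H.verts, ∀ u, g v = some u → u ∈ G.verts
  consistent : ∀ u ∈ G.verts, ∀ v ∈ H.verts, (f u = some v ↔ g v = some u)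

/-- The image `π(e) = (π(u₁), π(u₂))` of an edge under a matching: it is the dummy edge `none`
if either endpoint is matched with the dummy vertex, or if the image is not an edge of the
target graph `T`. -/
def mEdge {d : ℕ} (T : EGraph d) (φ : Pt d → Option (Pt d)) (e : Pt d × Pt d) :
    Option (Pt d × Pt d) :=
  match φ e.1, φ e.2 with
  | some a, some b => if (a, b) ∈ T.edges then some (a, b) else none
  | _, _ => none

/-- The cost of an inexact matching: vertex translations, edge translations, and deletions of
the unmatched edges from both graphs. -/
def matchCost {d : ℕ} (CV CE : ℝ) {G H : EGraph d} (m : Matching d G H) : ℝ :=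
  (∑ u ∈ G.verts.filter (fun u => m.f u ≠ none), CV * odist (some u) (m.f u)) +
  (∑ e ∈ G.edges.filter (fun e => mEdge H m.f e ≠ none),
      CE * |dist e.1 e.2 - elen (mEdge H m.f e)|) +
  (∑ e ∈ G.edges.filter (fun e => mEdge H m.f e = none), CE * dist e.1 e.2) +
  (∑ f ∈ H.edges.filter (fun f => mEdge G m.g f = none), CE * dist f.1 f.2)

/-- The geometric graph distance: the minimum cost of an inexact matching. -/
def GGD {d : ℕ} (CV CE : ℝ) (G H : GeoGraph d) : ℝ :=
  sInf {c : ℝ | ∃ m : Matching d G.toEGraph H.toEGraph, matchCost CV CE m = c}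

/-- The point `(a, b)` of `ℝ²`. -/
def pt2 (a b : ℝ) : Pt 2 := (WithLp.equiv 2 (Fin 2 → ℝ)).symm ![a, b]

/-- The point `a` of `ℝ¹`. -/
def pt1 (a : ℝ) : Pt 1 := (WithLp.equiv 2 (Fin 1 → ℝ)).symm ![a]

/-- The vertex set of a blob of size `k` with rows at heights `L` (upper) and `0` (lower),
horizontal offset `c` and horizontal spacing `s`: upper vertices `u_j = (c + j·s, L)` and
lower vertices `l_j = (c + (j+1)·s, 0)` for `j = 0, …, k−1`, so that the lower row is
obtained from the upper row by a half-step shift and consecutive vertices in each row are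
equidistant. -/
def blobVerts (L c s : ℝ) (k : ℕ) : Finset (Pt 2) :=
  ((Finset.range k).image fun j => pt2 (c + j * s) L) ∪
  ((Finset.range k).image fun j => pt2 (c + (j + 1) * s) 0)

/-- The edge set of a blob of size `k`: each upper vertex `u_j` is joined to `l_j` by a
slanted edge (all slanted edges have equal length), and, for `j ≥ 1`, each `u_j` is joined to
`l_{j−1}` by a vertical edge of length `L`; in particular `u_0` is joined only to `l_0`. -/
def blobEdges (L c s : ℝ) (k : ℕ) : Finset (Pt 2 × Pt 2) :=
  ((Finset.range k).image fun j =>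
    (pt2 (c + j * s) L, pt2 (c + (j + 1) * s) 0)) ∪
  (((Finset.range k).filter fun j => 1 ≤ j).image fun j =>
    (pt2 (c + j * s) L, pt2 (c + j * s) 0))

lemma pt2_inj {a b a' b' : ℝ} : pt2 a b = pt2 a' b' ↔ a = a' ∧ b = b' := by
  constructor
  · intro h
    have h0 : (pt2 a b) 0 = (pt2 a' b') 0 := by rw [h]
    have h1 : (pt2 a b) 1 = (pt2 a' b') 1 := by rw [h]
    simp [pt2] at h0 h1
    exact ⟨h0, h1⟩
  · rintro ⟨rfl, rfl⟩; rfl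

lemma pt2_zero (a b : ℝ) : (pt2 a b) 0 = a := by simp [pt2]
lemma pt2_one (a b : ℝ) : (pt2 a b) 1 = b := by simp [pt2]

lemma dist_pt2 (a b a' b' : ℝ) :
    dist (pt2 a b) (pt2 a' b') = Real.sqrt ((a - a') ^ 2 + (b - b') ^ 2) := by
  rw [EuclideanSpace.dist_eq]
  simp [pt2, Fin.sum_univ_two, Real.dist_eq, sq_abs]

lemma mem_blobVerts {L c s : ℝ} {k : ℕ} {p : Pt 2} :
    p ∈ blobVerts L c s k ↔ (∃ j < k, p = pt2 (c + j * s) L) ∨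
      (∃ j < k, p = pt2 (c + (j + 1) * s) 0) := by
  simp [blobVerts, eq_comm]

lemma mem_blobEdges {L c s : ℝ} {k : ℕ} {e : Pt 2 × Pt 2} :
    e ∈ blobEdges L c s k ↔
      (∃ j < k, e = (pt2 (c + j * s) L, pt2 (c + (j + 1) * s) 0)) ∨
      (∃ j < k, 1 ≤ j ∧ e = (pt2 (c + j * s) L, pt2 (c + j * s) 0)) := by
  simp [blobEdges, eq_comm, and_assoc]

lemma blobEdges_eq (L c s : ℝ) (k : ℕ) : blobEdges L c s k =
    ((Finset.range k).image fun j : ℕ =>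
      (pt2 (c + (j : ℝ) * s) L, pt2 (c + ((j : ℝ) + 1) * s) 0)) ∪
    (((Finset.range k).filter fun j => 1 ≤ j).image fun j : ℕ =>
      (pt2 (c + (j : ℝ) * s) L, pt2 (c + (j : ℝ) * s) 0)) := by
  ext e
  rw [mem_blobEdges]
  simp [eq_comm, and_assoc]

/-- a horizontal position determines the blob and the index -/
lemma loc {n : ℕ} {s : ℝ} (hs : 0 < s) {c : Fin n → ℝ} {k : Fin n → ℕ}
    (sep : ∀ i j, i < j → c i + (k i : ℝ) * s < c j)
    {i i' : Fin n} {j j' : ℕ} (hj : j ≤ k i) (hj' : j' ≤ k i')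
    (h : c i + j * s = c i' + j' * s) : i = i' ∧ j = j' := by
  have h1 : (j : ℝ) * s ≤ k i * s := by gcongr
  have h2 : (j' : ℝ) * s ≤ k i' * s := by gcongr
  have h3 : 0 ≤ (j : ℝ) * s := by positivity
  have h4 : 0 ≤ (j' : ℝ) * s := by positivity
  rcases lt_trichotomy i i' with hl | rfl | hl
  · have := sep _ _ hl; linarith
  · refine ⟨rfl, ?_⟩
    have : (j : ℝ) * s = j' * s := by linarith
    exact_mod_cast mul_right_cancel₀ hs.ne' this
  · have := sep _ _ hl; linarith

lemma sum_edges {n : ℕ} {s L : ℝ} (hs : 0 < s) {c : Fin n → ℝ} {k : Fin n → ℕ}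
    (sep : ∀ i j, i < j → c i + (k i : ℝ) * s < c j) (F : Pt 2 × Pt 2 → ℝ) :
    ∑ e ∈ Finset.univ.biUnion (fun i => blobEdges L (c i) s (k i)), F e =
    ∑ i, (∑ j ∈ Finset.range (k i), F (pt2 (c i + j * s) L, pt2 (c i + (j + 1) * s) 0) +
      ∑ j ∈ (Finset.range (k i)).filter (fun j => 1 ≤ j),
        F (pt2 (c i + j * s) L, pt2 (c i + j * s) 0)) := by
  rw [Finset.sum_biUnion]
  · refine Finset.sum_congr rfl fun i _ => ?_
    rw [blobEdges_eq]
    rw [Finset.sum_union, Finset.sum_image, Finset.sum_image]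
    · intro j hj j' hj' h
      simp only [Prod.mk.injEq, pt2_inj] at h
      simp at hj hj'
      exact (loc hs sep hj.1.le hj'.1.le h.1.1).2
    · intro j hj j' hj' h
      simp only [Prod.mk.injEq, pt2_inj] at h
      simp at hj hj'
      exact (loc hs sep hj.le hj'.le h.1.1).2
    · rw [Finset.disjoint_left]
      intro e h1 h2
      simp only [Finset.mem_image, Finset.mem_filter, Finset.mem_range] at h1 h2
      obtain ⟨j, hj, rfl⟩ := h1
      obtain ⟨j', ⟨hj', -⟩, h⟩ := h2
      simp only [Prod.mk.injEq, pt2_inj] at h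
      nlinarith [h.1.1, h.2.1]
  · intro i _ i' _ hne
    rw [Function.onFun, Finset.disjoint_left]
    intro e h1 h2
    have key : ∀ i, e ∈ blobEdges L (c i) s (k i) → ∃ j ≤ k i, e.1 = pt2 (c i + j * s) L := by
      intro i h
      rcases mem_blobEdges.1 h with ⟨j, hj, rfl⟩ | ⟨j, hj, -, rfl⟩ <;> exact ⟨j, hj.le, rfl⟩
    obtain ⟨j, hj, e1⟩ := key i h1
    obtain ⟨j', hj', e2⟩ := key i' h2
    rw [e1, pt2_inj] at e2
    exact hne (loc hs sep hj hj' e2.1).1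

lemma mEdge_eq_some {d : ℕ} {T : EGraph d} {φ : Pt d → Option (Pt d)} {e q : Pt d × Pt d} :
    mEdge T φ e = some q ↔ φ e.1 = some q.1 ∧ φ e.2 = some q.2 ∧ q ∈ T.edges := by
  obtain ⟨q1, q2⟩ := q
  unfold mEdge
  rcases φ e.1 with _ | a <;> rcases φ e.2 with _ | b <;> simp
  constructor
  · rintro ⟨h, rfl, rfl⟩; exact ⟨rfl, rfl, h⟩
  · rintro ⟨rfl, rfl, h⟩; exact ⟨h, rfl, rfl⟩

/-- matched edges correspond -/
lemma mEdge_symm {d : ℕ} {G H : GeoGraph d} (m : Matching d G.toEGraph H.toEGraph)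
    {e q : Pt d × Pt d} (he : e ∈ G.edges) (hq : q ∈ H.edges) :
    mEdge H.toEGraph m.f e = some q ↔ mEdge G.toEGraph m.g q = some e := by
  rw [mEdge_eq_some, mEdge_eq_some,
    m.consistent _ (G.edge_fst_mem _ he) _ (H.edge_fst_mem _ hq),
    m.consistent _ (G.edge_snd_mem _ he) _ (H.edge_snd_mem _ hq)]
  simp [he, hq]

lemma sum_matched {d : ℕ} {G H : GeoGraph d} (m : Matching d G.toEGraph H.toEGraph)
    (F : Pt d × Pt d → ℝ) :
    ∑ e ∈ G.edges.filter (fun e => mEdge H.toEGraph m.f e ≠ none),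
      F ((mEdge H.toEGraph m.f e).getD e) =
    ∑ q ∈ H.edges.filter (fun q => mEdge G.toEGraph m.g q ≠ none), F q := by
  refine Finset.sum_nbij' (fun e => (mEdge H.toEGraph m.f e).getD e)
    (fun q => (mEdge G.toEGraph m.g q).getD q) ?_ ?_ ?_ ?_ ?_
  · intro e he
    obtain ⟨he, hn⟩ := Finset.mem_filter.1 he
    obtain ⟨q, hq⟩ := Option.ne_none_iff_exists'.1 hn
    have hqH := (mEdge_eq_some.1 hq).2.2
    have := (mEdge_symm m he hqH).1 hq
    simp [hq, hqH, this]
  · intro q he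
    obtain ⟨he, hn⟩ := Finset.mem_filter.1 he
    obtain ⟨e, hq⟩ := Option.ne_none_iff_exists'.1 hn
    have hqH := (mEdge_eq_some.1 hq).2.2
    have := (mEdge_symm m hqH he).2 hq
    simp [hq, hqH, this]
  · intro e he
    obtain ⟨he, hn⟩ := Finset.mem_filter.1 he
    obtain ⟨q, hq⟩ := Option.ne_none_iff_exists'.1 hn
    have hqH := (mEdge_eq_some.1 hq).2.2
    have := (mEdge_symm m he hqH).1 hq
    simp [hq, this]
  · intro q he
    obtain ⟨he, hn⟩ := Finset.mem_filter.1 he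
    obtain ⟨e, hq⟩ := Option.ne_none_iff_exists'.1 hn
    have hqH := (mEdge_eq_some.1 hq).2.2
    have := (mEdge_symm m hqH he).2 hq
    simp [hq, this]
  · intro e he
    rfl

/-- total vertex and edge counts -/
lemma card_edges {n : ℕ} {s L : ℝ} (hs : 0 < s) {c : Fin n → ℝ} {k : Fin n → ℕ}
    (hk : ∀ i, 1 ≤ k i)
    (sep : ∀ i j, i < j → c i + (k i : ℝ) * s < c j) (α β : ℝ) (F : Pt 2 × Pt 2 → ℝ)
    (h1 : ∀ x, F (pt2 x L, pt2 (x + s) 0) = α) (h2 : ∀ x, F (pt2 x L, pt2 x 0) = β) :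
    ∑ e ∈ Finset.univ.biUnion (fun i => blobEdges L (c i) s (k i)), F e =
    (∑ i, k i : ℕ) * α + ((∑ i, k i : ℕ) - n) * β := by
  rw [sum_edges hs sep]
  have : ∀ i, (∑ j ∈ Finset.range (k i), F (pt2 (c i + j * s) L, pt2 (c i + (j + 1) * s) 0) +
      ∑ j ∈ (Finset.range (k i)).filter (fun j => 1 ≤ j),
        F (pt2 (c i + j * s) L, pt2 (c i + j * s) 0)) = k i * α + ((k i : ℝ) - 1) * β := by
    intro i
    have e1 : (Finset.range (k i)).filter (fun j => 1 ≤ j) = Finset.Ico 1 (k i) := by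
      ext j; simp; tauto
    simp only [h2, e1]
    have h1' : ∀ j : ℕ, F (pt2 (c i + j * s) L, pt2 (c i + (j + 1) * s) 0) = α := by
      intro j
      rw [← h1 (c i + j * s)]; congr 3; ring
    simp only [h1']
    simp [Nat.cast_sub (hk i)]
  simp only [this, Finset.sum_add_distrib, ← Finset.sum_mul]
  simp

lemma matchCost_nonneg {d : ℕ} {CV CE : ℝ} (hCV : 0 < CV) (hCE : 0 < CE)
    {G H : EGraph d} (m : Matching d G H) : 0 ≤ matchCost CV CE m := by
  have ho : ∀ a b : Option (Pt d), 0 ≤ odist a b := by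
    intro a b
    rcases a with _ | a <;> rcases b with _ | b <;> simp [odist, dist_nonneg]
  unfold matchCost
  have h1 := fun u => mul_nonneg hCV.le (ho (some u) (m.f u))
  have := Finset.sum_nonneg (s := G.verts.filter (fun u => m.f u ≠ none)) (fun u _ => h1 u)
  refine add_nonneg (add_nonneg (add_nonneg this ?_) ?_) ?_ <;>
    exact Finset.sum_nonneg fun _ _ => by positivity

/-- matching from an injective map -/
lemma exists_matching {d : ℕ} {G H : EGraph d} (φ : Pt d → Pt d)
    (hm : ∀ u ∈ G.verts, φ u ∈ H.verts) (hi : Set.InjOn φ ↑G.verts) :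
    ∃ m : Matching d G H, m.f = fun u => some (φ u) := by
  refine ⟨⟨fun u => some (φ u),
    fun v => if h : ∃ u ∈ G.verts, φ u = v then some h.choose else none, ?_, ?_, ?_⟩, rfl⟩
  · intro u hu v hv
    simp at hv; subst hv; exact hm u hu
  · intro v hv u hu
    split_ifs at hu with h
    simp at hu; subst hu; exact h.choose_spec.1
  · intro u hu v hv
    simp only [Option.some.injEq]
    constructor
    · rintro rfl
      have h : ∃ u' ∈ G.verts, φ u' = φ u := ⟨u, hu, rfl⟩
      rw [dif_pos h]
      exact congrArg some (hi h.choose_spec.1 hu h.choose_spec.2)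
    · intro h
      split_ifs at h with h'
      simp at h; subst h; exact h'.choose_spec.2

lemma mem_blobVerts' {L c s : ℝ} {k : ℕ} {p : Pt 2} :
    p ∈ blobVerts L c s k ↔ ∃ (j : ℕ) (h : ℝ), j ≤ k ∧ p = pt2 (c + j * s) h ∧
      ((h = L ∧ j < k) ∨ (h = 0 ∧ 1 ≤ j)) := by
  rw [mem_blobVerts]
  constructor
  · rintro (⟨j, hj, rfl⟩ | ⟨j, hj, rfl⟩)
    · exact ⟨j, L, hj.le, rfl, Or.inl ⟨rfl, hj⟩⟩
    · exact ⟨j + 1, 0, hj, by push_cast; rfl, Or.inr ⟨rfl, by omega⟩⟩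
  · rintro ⟨j, h, hj, rfl, ⟨rfl, hj'⟩ | ⟨rfl, hj'⟩⟩
    · exact Or.inl ⟨j, hj', rfl⟩
    · obtain ⟨j, rfl⟩ := Nat.exists_eq_add_of_le' hj'
      exact Or.inr ⟨j, hj, by push_cast; rfl⟩

lemma card_blobVerts_le (L c s : ℝ) (k : ℕ) : (blobVerts L c s k).card ≤ 2 * k := by
  have : blobVerts L c s k =
    ((Finset.range k).image fun j : ℕ => pt2 (c + (j : ℝ) * s) L) ∪
    ((Finset.range k).image fun j : ℕ => pt2 (c + ((j : ℝ) + 1) * s) 0) := by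
    ext e
    rw [mem_blobVerts]
    simp [eq_comm]
  rw [this]
  refine (Finset.card_union_le _ _).trans ?_
  have h1 := Finset.card_image_le (s := Finset.range k) (f := fun j : ℕ => pt2 (c + (j : ℝ) * s) L)
  have h2 := Finset.card_image_le (s := Finset.range k)
    (f := fun j : ℕ => pt2 (c + ((j : ℝ) + 1) * s) 0)
  rw [Finset.card_range] at h1 h2
  omega

lemma exists_shift {n : ℕ} {s : ℝ} (hs : 0 < s) {c : Fin n → ℝ} {k : Fin n → ℕ}
    (sep : ∀ i j, i < j → c i + (k i : ℝ) * s < c j) (d : Fin n → ℝ) :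
    ∃ sh : ℝ → ℝ, ∀ i (j : ℕ), j ≤ k i → sh (c i + j * s) = d i := by
  refine ⟨fun y => if h : ∃ i, ∃ j : ℕ, j ≤ k i ∧ y = c i + j * s then d h.choose else 0, ?_⟩
  intro i j hj
  have h : ∃ i', ∃ j' : ℕ, j' ≤ k i' ∧ c i + j * s = c i' + j' * s := ⟨i, j, hj, rfl⟩
  simp only
  rw [dif_pos h]
  obtain ⟨j', hj', e⟩ := h.choose_spec
  rw [← (loc hs sep hj hj' e).1]

lemma len_slant (L s y : ℝ) :
    dist (pt2 y L) (pt2 (y + s) 0) = Real.sqrt (s ^ 2 + L ^ 2) := by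
  rw [dist_pt2]; congr 1; ring

lemma len_vert {L : ℝ} (hL : 0 < L) (y : ℝ) : dist (pt2 y L) (pt2 y 0) = L := by
  rw [dist_pt2]; simp [hL.le, Real.sqrt_sq]

lemma forward {CV CE : ℝ} (hCV : 0 < CV)
    {N B : ℕ} (hB : 0 < B)
    {a : Fin (3 * N) → ℕ} (ha : ∀ i, 1 ≤ a i)
    (hsum : ∑ i, a i = N * B)
    {x L : ℝ} (hL : 0 < L) (hx0 : 0 ≤ x)
    {s : ℝ} (hs : 0 < s)
    {cG : Fin (3 * N) → ℝ} {cH : Fin N → ℝ}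
    (hG0 : ∀ i, 0 ≤ cG i)
    (hGsep : ∀ i j, i < j → cG i + (a i : ℝ) * s < cG j)
    (hGH : ∀ i j, cG i + (a i : ℝ) * s < cH j)
    (hHsep : ∀ i j, i < j → cH i + (B : ℝ) * s < cH j)
    (hHbox : ∀ j, cH j + (B : ℝ) * s ≤ x)
    {G H : GeoGraph 2}
    (hGv : G.verts = Finset.univ.biUnion fun i : Fin (3 * N) => blobVerts L (cG i) s (a i))
    (hGe : G.edges = Finset.univ.biUnion fun i : Fin (3 * N) => blobEdges L (cG i) s (a i))
    (hHv : H.verts = Finset.univ.biUnion fun j : Fin N => blobVerts L (cH j) s B)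
    (hHe : H.edges = Finset.univ.biUnion fun j : Fin N => blobEdges L (cH j) s B)
    (f : Fin (3 * N) → Fin N)
    (hf : ∀ t, ∑ i ∈ Finset.univ.filter (fun i => f i = t), a i = B) :
    ∃ m : Matching 2 G.toEGraph H.toEGraph,
      matchCost CV CE m ≤ 2 * N * B * CV * x + CE * (2 * N * L) := by
  set o : Fin (3 * N) → ℕ := fun i =>
    ∑ i' ∈ Finset.univ.filter (fun i' => f i' = f i ∧ i' < i), a i' with ho
  have hins : ∀ i, o i + a i =
      ∑ i' ∈ insert i (Finset.univ.filter (fun i' => f i' = f i ∧ i' < i)), a i' := by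
    intro i
    rw [Finset.sum_insert (by simp), add_comm]
  have hoB : ∀ i, o i + a i ≤ B := by
    intro i
    rw [hins, ← hf (f i)]
    apply Finset.sum_le_sum_of_subset
    intro k hk
    simp at hk ⊢
    rcases hk with rfl | hk
    · rfl
    · exact hk.1
  have hoL : ∀ i i', i < i' → f i = f i' → o i + a i ≤ o i' := by
    intro i i' hlt hff
    rw [hins]
    apply Finset.sum_le_sum_of_subset
    intro k hk
    simp at hk ⊢
    rcases hk with rfl | hk
    · exact ⟨hff, hlt⟩
    · exact ⟨hk.1.trans hff, hk.2.trans hlt⟩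
  obtain ⟨sh, hsh⟩ := exists_shift hs hGsep (fun i => cH (f i) + o i * s - cG i)
  set φ : Pt 2 → Pt 2 := fun p => pt2 (p 0 + sh (p 0)) (p 1) with hφ
  have hφp : ∀ i (j : ℕ) h, j ≤ a i →
      φ (pt2 (cG i + j * s) h) = pt2 (cH (f i) + ((o i + j : ℕ) : ℝ) * s) h := by
    intro i j h hj
    simp only [hφ, pt2_zero, pt2_one, hsh i j hj]
    congr 1; push_cast; ring
  have hGm : ∀ u ∈ G.verts, ∃ i, ∃ (j : ℕ) (h : ℝ), j ≤ a i ∧ u = pt2 (cG i + j * s) h ∧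
      ((h = L ∧ j < a i) ∨ (h = 0 ∧ 1 ≤ j)) := by
    intro u hu
    rw [hGv] at hu
    simp only [Finset.mem_biUnion, Finset.mem_univ, true_and, mem_blobVerts'] at hu
    exact hu
  have hmaps : ∀ u ∈ G.verts, φ u ∈ H.verts := by
    intro u hu
    obtain ⟨i, j, h, hj, rfl, hh⟩ := hGm u hu
    rw [hφp i j h hj, hHv]
    simp only [Finset.mem_biUnion, Finset.mem_univ, true_and, mem_blobVerts']
    have := hoB i
    refine ⟨f i, o i + j, h, by omega, rfl, ?_⟩
    rcases hh with hh | hh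
    · left; exact ⟨hh.1, by omega⟩
    · right; exact ⟨hh.1, by omega⟩
  have hinj : Set.InjOn φ ↑G.verts := by
    intro u hu u' hu' he
    obtain ⟨i, j, h, hj, rfl, hh⟩ := hGm u hu
    obtain ⟨i', j', h', hj', rfl, hh'⟩ := hGm u' hu'
    rw [hφp i j h hj, hφp i' j' h' hj', pt2_inj] at he
    obtain ⟨he, rfl⟩ := he
    have b1 := hoB i
    have b2 := hoB i'
    obtain ⟨e1, e2⟩ := loc hs (k := fun _ => B) hHsep (by omega) (by omega) he
    rcases lt_trichotomy i i' with hl | rfl | hl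
    · have := hoL _ _ hl e1
      rcases hh with hh | hh
      · omega
      · rcases hh' with hh' | hh'
        · exact absurd (hh'.1.symm.trans hh.1) hL.ne'
        · omega
    · have : j = j' := by omega
      rw [this]
    · have := hoL _ _ hl e1.symm
      rcases hh' with hh' | hh'
      · omega
      · rcases hh with hh | hh
        · exact absurd (hh.1.symm.trans hh'.1) hL.ne'
        · omega
  obtain ⟨m, hm⟩ := exists_matching φ hmaps hinj
  refine ⟨m, ?_⟩
  have hedge : ∀ e ∈ G.edges, (φ e.1, φ e.2) ∈ H.edges ∧ dist (φ e.1) (φ e.2) = dist e.1 e.2 := by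
    intro e he
    rw [hGe] at he
    simp only [Finset.mem_biUnion, Finset.mem_univ, true_and, mem_blobEdges] at he
    obtain ⟨i, he⟩ := he
    have := hoB i
    rw [hHe]
    simp only [Finset.mem_biUnion, Finset.mem_univ, true_and, mem_blobEdges]
    rcases he with ⟨j, hj, rfl⟩ | ⟨j, hj, h1, rfl⟩
    · have e1 := hφp i j L hj.le
      have e2 := hφp i (j + 1) 0 hj
      push_cast at e1 e2
      simp only [e1, e2]
      constructor
      · refine ⟨f i, Or.inl ⟨o i + j, by omega, ?_⟩⟩
        push_cast
        congr 3; ring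
      · rw [show cH (f i) + ((o i : ℝ) + (j + 1)) * s = cH (f i) + ((o i : ℝ) + j) * s + s by ring,
          show cG i + ((j : ℝ) + 1) * s = cG i + j * s + s by ring, len_slant, len_slant]
    · have e1 := hφp i j L hj.le
      have e2 := hφp i j 0 hj.le
      simp only [e1, e2]
      constructor
      · exact ⟨f i, Or.inr ⟨o i + j, by omega, by omega, rfl⟩⟩
      · rw [len_vert hL, len_vert hL]
  have hmE : ∀ e ∈ G.edges, mEdge H.toEGraph m.f e = some (φ e.1, φ e.2) := by
    intro e he
    rw [mEdge_eq_some, hm]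
    exact ⟨rfl, rfl, (hedge e he).1⟩
  have hfull : G.edges.filter (fun e => mEdge H.toEGraph m.f e ≠ none) = G.edges := by
    apply Finset.filter_true_of_mem
    intro e he
    rw [hmE e he]; simp
  have hempty : G.edges.filter (fun e => mEdge H.toEGraph m.f e = none) = ∅ := by
    apply Finset.filter_false_of_mem
    intro e he
    rw [hmE e he]; simp
  -- volumes
  have hvG : ∑ e ∈ G.edges, dist e.1 e.2 =
      ((N * B : ℕ) : ℝ) * Real.sqrt (s ^ 2 + L ^ 2) + ((N * B : ℕ) - (3 * N : ℕ)) * L := by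
    rw [hGe, card_edges hs ha hGsep _ _ (fun e => dist e.1 e.2) (len_slant L s) (len_vert hL), hsum]
  have hvH : ∑ e ∈ H.edges, dist e.1 e.2 =
      ((N * B : ℕ) : ℝ) * Real.sqrt (s ^ 2 + L ^ 2) + ((N * B : ℕ) - (N : ℕ)) * L := by
    rw [hHe, card_edges hs (k := fun _ => B) (fun _ => hB) hHsep _ _ (fun e => dist e.1 e.2)
      (len_slant L s) (len_vert hL)]
    simp
  have hmat := sum_matched m (fun e => dist e.1 e.2)
  rw [hfull, Finset.sum_congr rfl (g := fun e => dist e.1 e.2) (fun e he => by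
    rw [hmE e he]; exact (hedge e he).2)] at hmat
  have hsplit := Finset.sum_filter_add_sum_filter_not H.edges
    (fun q => mEdge G.toEGraph m.g q = none) (fun q => dist q.1 q.2)
  unfold matchCost
  rw [hfull, hempty, ← Finset.mul_sum]
  have t2 : ∑ e ∈ G.edges, CE * |dist e.1 e.2 - elen (mEdge H.toEGraph m.f e)| = 0 := by
    apply Finset.sum_eq_zero
    intro e he
    rw [hmE e he]
    simp [elen, (hedge e he).2]
  have t4 : ∑ q ∈ H.edges.filter (fun q => mEdge G.toEGraph m.g q = none), CE * dist q.1 q.2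
      = CE * (2 * N * L) := by
    rw [← Finset.mul_sum]
    congr 1
    simp only [ne_eq] at hmat
    rw [← hmat, hvG, hvH] at hsplit
    push_cast at hsplit
    linarith
  have t1 : ∑ u ∈ G.verts.filter (fun u => m.f u ≠ none), CV * odist (some u) (m.f u)
      ≤ 2 * N * B * CV * x := by
    have hb : ∀ u ∈ G.verts.filter (fun u => m.f u ≠ none),
        CV * odist (some u) (m.f u) ≤ CV * x := by
      intro u hu
      have hu := (Finset.mem_filter.1 hu).1
      rw [hm]
      apply mul_le_mul_of_nonneg_left _ hCV.le
      obtain ⟨i, j, h, hj, rfl, hh⟩ := hGm u hu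
      show odist _ (some (φ _)) ≤ x
      rw [hφp i j h hj]
      simp only [odist, dist_pt2, sub_self]
      rw [zero_pow two_ne_zero, add_zero, Real.sqrt_sq_eq_abs, abs_le]
      have q1 : (j : ℝ) * s ≤ a i * s := by gcongr
      have q2 : ((o i + j : ℕ) : ℝ) * s ≤ B * s := by
        have := hoB i
        have : o i + j ≤ B := by omega
        gcongr
      have q3 : 0 ≤ (j : ℝ) * s := by positivity
      have q4 : 0 ≤ ((o i + j : ℕ) : ℝ) * s := by positivity
      have q5 := hGH i (f i)
      have q6 := hG0 i
      have q7 := hHbox (f i)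
      constructor <;> linarith
    refine (Finset.sum_le_card_nsmul _ _ _ hb).trans ?_
    have hcard : (G.verts.filter (fun u => m.f u ≠ none)).card ≤ 2 * (N * B) := by
      refine (Finset.card_filter_le _ _).trans ?_
      rw [hGv]
      refine Finset.card_biUnion_le.trans ?_
      rw [← hsum, Finset.mul_sum]
      exact Finset.sum_le_sum fun i _ => card_blobVerts_le _ _ _ _
    rw [nsmul_eq_mul]
    have hcard' : (((G.verts.filter (fun u => m.f u ≠ none)).card : ℕ) : ℝ) ≤ 2 * (N * B) := by
      exact_mod_cast hcard
    have : 0 ≤ CV * x := by positivity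
    nlinarith [mul_le_mul_of_nonneg_right hcard' this]
  simp only [Finset.sum_empty, add_zero]
  rw [Finset.mul_sum, t2, t4] 
  linarith

lemma triple_card {N B : ℕ} (hB : 0 < B) {a : Fin (3 * N) → ℕ}
    (ha₁ : ∀ i, B + 1 ≤ 4 * a i) (ha₂ : ∀ i, 2 * a i + 1 ≤ B)
    (F : Finset (Fin (3 * N))) (h : ∑ i ∈ F, a i = B) : F.card = 3 := by
  have h1 : F.card * (B + 1) ≤ 4 * B := by
    rw [← h, Finset.mul_sum, h, ← smul_eq_mul]
    exact Finset.card_nsmul_le_sum _ _ _ fun i _ => ha₁ i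
  have h2 : 2 * B + F.card ≤ F.card * B := by
    have : ∑ i ∈ F, (2 * a i + 1) ≤ F.card • B :=
      Finset.sum_le_card_nsmul _ _ _ fun i _ => ha₂ i
    rw [Finset.sum_add_distrib, ← Finset.mul_sum, h] at this
    simpa using this
  have h3 : F.card < 4 := by by_contra hh; push Not at hh; nlinarith
  have h4 : 2 < F.card := by by_contra hh; push Not at hh; nlinarith
  omega

lemma backward {N B : ℕ} 
    {a : Fin (3 * N) → ℕ} 
    (hsum : ∑ i, a i = N * B)
    {L : ℝ}
    {s : ℝ} (hs : 0 < s)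
    {cG : Fin (3 * N) → ℝ} {cH : Fin N → ℝ} (ha : ∀ i, 1 ≤ a i)
    (hGsep : ∀ i j, i < j → cG i + (a i : ℝ) * s < cG j)
    (hHsep : ∀ i j, i < j → cH i + (B : ℝ) * s < cH j)
    {G H : GeoGraph 2}
    (hGe : G.edges = Finset.univ.biUnion fun i : Fin (3 * N) => blobEdges L (cG i) s (a i))
    (hHe : H.edges = Finset.univ.biUnion fun j : Fin N => blobEdges L (cH j) s B)
    (m : Matching 2 G.toEGraph H.toEGraph)
    (hall : ∀ e ∈ G.edges, mEdge H.toEGraph m.f e ≠ none) :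
    ∃ f : Fin (3 * N) → Fin N,
      ∀ t, ∑ i ∈ Finset.univ.filter (fun i => f i = t), a i = B := by
  have hedge : ∀ e ∈ G.edges, ∃ t, ∃ j1 j2 : ℕ, j1 < B ∧ j2 ≤ B ∧
      m.f e.1 = some (pt2 (cH t + j1 * s) L) ∧ m.f e.2 = some (pt2 (cH t + j2 * s) 0) := by
    intro e he
    obtain ⟨q, hq⟩ := Option.ne_none_iff_exists'.1 (hall e he)
    obtain ⟨h1, h2, h3⟩ := mEdge_eq_some.1 hq
    rw [hHe] at h3
    simp only [Finset.mem_biUnion, Finset.mem_univ, true_and, mem_blobEdges] at h3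
    obtain ⟨t, ⟨j, hj, rfl⟩ | ⟨j, hj, -, rfl⟩⟩ := h3
    · exact ⟨t, j, j + 1, hj, hj, h1, by rw [h2]; push_cast; rfl⟩
    · exact ⟨t, j, j, hj, hj.le, h1, h2⟩
  have hsl : ∀ i, ∀ j < a i,
      ((pt2 (cG i + j * s) L, pt2 (cG i + (j + 1) * s) 0) : Pt 2 × Pt 2) ∈ G.edges := by
    intro i j hj
    rw [hGe]
    simp only [Finset.mem_biUnion, Finset.mem_univ, true_and, mem_blobEdges]
    exact ⟨i, Or.inl ⟨j, hj, rfl⟩⟩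
  have hve : ∀ i, ∀ j : ℕ, j + 1 < a i →
      ((pt2 (cG i + (j + 1) * s) L, pt2 (cG i + (j + 1) * s) 0) : Pt 2 × Pt 2) ∈ G.edges := by
    intro i j hj
    rw [hGe]
    simp only [Finset.mem_biUnion, Finset.mem_univ, true_and, mem_blobEdges]
    exact ⟨i, Or.inr ⟨j + 1, hj, by omega, by push_cast; rfl⟩⟩
  have hconn : ∀ i, ∃ t, ∀ j < a i, ∃ j1 j2 : ℕ, j1 < B ∧ j2 ≤ B ∧
      m.f (pt2 (cG i + j * s) L) = some (pt2 (cH t + j1 * s) L) ∧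
      m.f (pt2 (cG i + (j + 1) * s) 0) = some (pt2 (cH t + j2 * s) 0) := by
    intro i
    obtain ⟨t, j1, j2, b1, b2, e1, e2⟩ := hedge _ (hsl i 0 (ha i))
    refine ⟨t, ?_⟩
    intro j
    induction j with
    | zero => intro _; exact ⟨j1, j2, b1, b2, e1, e2⟩
    | succ j ih =>
      intro hj
      obtain ⟨p1, p2, c1, c2, g1, g2⟩ := ih (by omega)
      obtain ⟨t', q1, q2, d1, d2, k1, k2⟩ := hedge _ (hve i j hj)
      obtain ⟨t'', r1, r2, f1, f2, l1, l2⟩ := hedge _ (hsl i (j + 1) hj)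
      simp only at k1 k2 l1 l2
      rw [g2, Option.some.injEq, pt2_inj] at k2
      obtain ⟨rfl, -⟩ := loc hs (k := fun _ => B) hHsep c2 d2 k2.1
      have l1' := l1
      push_cast at l1'
      rw [k1, Option.some.injEq, pt2_inj] at l1'
      obtain ⟨rfl, -⟩ := loc hs (k := fun _ => B) hHsep d1.le f1.le l1'.1
      exact ⟨r1, r2, f1, f2, l1, l2⟩
  choose t ht using hconn
  refine ⟨t, ?_⟩
  have hJ : ∀ i j, ∃ J : ℕ, j < a i → J < B ∧
      m.f (pt2 (cG i + j * s) L) = some (pt2 (cH (t i) + J * s) L) := by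
    intro i j
    by_cases h : j < a i
    · obtain ⟨j1, j2, h1, h2, h3, h4⟩ := ht i j h
      exact ⟨j1, fun _ => ⟨h1, h3⟩⟩
    · exact ⟨0, fun h' => absurd h' h⟩
  choose J hJ using hJ
  have hle : ∀ t0 ∈ (Finset.univ : Finset (Fin N)),
      ∑ i ∈ Finset.univ.filter (fun i => t i = t0), a i ≤ B := by
    intro t0 _
    have : ((Finset.univ.filter (fun i => t i = t0)).sigma fun i => Finset.range (a i)).card
        ≤ (Finset.range B).card := by
      apply Finset.card_le_card_of_injOn (fun p => J p.1 p.2)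
      · rintro ⟨i, j⟩ hp
        simp at hp ⊢
        exact (hJ i j hp.2).1
      · rintro ⟨i, j⟩ hp ⟨i', j'⟩ hp' he
        simp at hp hp' he
        obtain ⟨hp1, hp2⟩ := hp
        obtain ⟨hp1', hp2'⟩ := hp'
        have e1 := (hJ i j hp2).2
        have e2 := (hJ i' j' hp2').2
        rw [hp1, he] at e1
        rw [hp1'] at e2
        have g1 := G.edge_fst_mem _ (hsl i j hp2)
        have g2 := G.edge_fst_mem _ (hsl i' j' hp2')
        simp only at g1 g2
        have hv := m.f_mem _ g1 _ e1
        have c1 := (m.consistent _ g1 _ hv).1 e1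
        have c2 := (m.consistent _ g2 _ hv).1 e2
        rw [c1, Option.some.injEq, pt2_inj] at c2
        obtain ⟨rfl, rfl⟩ := loc hs hGsep hp2.le hp2'.le c2.1
        rfl
    simpa [Finset.card_sigma] using this
  have htot : ∑ t0 : Fin N, ∑ i ∈ Finset.univ.filter (fun i => t i = t0), a i
      = ∑ _t0 : Fin N, B := by
    rw [Finset.sum_fiberwise, hsum]; simp
  intro t0
  exact (Finset.sum_eq_sum_iff_of_le hle).1 htot t0 (Finset.mem_univ _)

/-- edges of both graphs have length at least `L` -/
lemma len_ge {L s : ℝ} (hL : 0 < L) {n : ℕ} {c : Fin n → ℝ} {k : Fin n → ℕ}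
    {e : Pt 2 × Pt 2} (he : e ∈ Finset.univ.biUnion (fun i => blobEdges L (c i) s (k i))) :
    L ≤ dist e.1 e.2 := by
  simp only [Finset.mem_biUnion, Finset.mem_univ, true_and, mem_blobEdges] at he
  obtain ⟨i, ⟨j, hj, rfl⟩ | ⟨j, hj, -, rfl⟩⟩ := he
  · simp only
    rw [dist_pt2]
    apply Real.le_sqrt_of_sq_le
    nlinarith [sq_nonneg (c i + j * s - (c i + (j + 1) * s))]
  · exact (len_vert hL _).ge

lemma gap {CV CE τ : ℝ} (hCV : 0 < CV) (hCE : 0 < CE)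
    {N B : ℕ} (hN : 1 < N) (hB : 3 ≤ B)
    {a : Fin (3 * N) → ℕ} (ha : ∀ i, 1 ≤ a i)
    (hsum : ∑ i, a i = N * B)
    {L : ℝ} (hL : 0 < L) (hτ : CE * L * (2 * N + 2) = τ)
    {s : ℝ} (hs : 0 < s)
    {cG : Fin (3 * N) → ℝ} {cH : Fin N → ℝ}
    (hGsep : ∀ i j, i < j → cG i + (a i : ℝ) * s < cG j)
    (hHsep : ∀ i j, i < j → cH i + (B : ℝ) * s < cH j)
    {G H : GeoGraph 2}
    (hGv : G.verts = Finset.univ.biUnion fun i : Fin (3 * N) => blobVerts L (cG i) s (a i))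
    (hGe : G.edges = Finset.univ.biUnion fun i : Fin (3 * N) => blobEdges L (cG i) s (a i))
    (hHv : H.verts = Finset.univ.biUnion fun j : Fin N => blobVerts L (cH j) s B)
    (hHe : H.edges = Finset.univ.biUnion fun j : Fin N => blobEdges L (cH j) s B)
    {δ : ℝ} (hδ : ∀ i j, δ ≤ cH j - (cG i + (a i : ℝ) * s))
    (m : Matching 2 G.toEGraph H.toEGraph)
    (hnot : ¬ ∀ e ∈ G.edges, mEdge H.toEGraph m.f e ≠ none) :
    τ + min (CV * δ) (CE * L) ≤ matchCost CV CE m := by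
  set P := G.edges.filter (fun e => mEdge H.toEGraph m.f e = none) with hP
  set Q := H.edges.filter (fun q => mEdge G.toEGraph m.g q = none) with hQ
  have hGc : ((G.edges.card : ℕ) : ℝ) = 2 * (N * B) - 3 * N := by
    have := card_edges (L := L) hs ha hGsep 1 1 (fun _ => 1) (fun _ => rfl) (fun _ => rfl)
    rw [← hGe, hsum] at this
    simp at this
    linarith
  have hHc : ((H.edges.card : ℕ) : ℝ) = 2 * (N * B) - N := by
    have := card_edges (L := L) hs (k := fun _ => B) (fun _ => by omega) hHsep 1 1
      (fun _ => 1) (fun _ => rfl) (fun _ => rfl)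
    rw [← hHe] at this
    simp at this
    linarith
  have hmat := sum_matched m (fun _ => 1)
  have sG := Finset.sum_filter_add_sum_filter_not G.edges
    (fun e => mEdge H.toEGraph m.f e = none) (fun _ => (1 : ℝ))
  have sH := Finset.sum_filter_add_sum_filter_not H.edges
    (fun e => mEdge G.toEGraph m.g e = none) (fun _ => (1 : ℝ))
  rw [← hP] at sG
  rw [← hQ] at sH
  simp only [ne_eq, Finset.sum_const, nsmul_eq_mul, mul_one] at hmat sG sH
  have hPQ : (Q.card : ℝ) = P.card + 2 * N := by linarith
  have hP1 : (1 : ℝ) ≤ P.card := by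
    push Not at hnot
    obtain ⟨e, he, hn⟩ := hnot
    have : 0 < P.card := Finset.card_pos.2 ⟨e, Finset.mem_filter.2 ⟨he, hn⟩⟩
    exact_mod_cast this
  have t3 : P.card * (CE * L) ≤ ∑ e ∈ P, CE * dist e.1 e.2 := by
    rw [← nsmul_eq_mul]
    apply Finset.card_nsmul_le_sum
    intro e he
    have he := (Finset.mem_filter.1 he).1
    rw [hGe] at he
    exact mul_le_mul_of_nonneg_left (len_ge hL he) hCE.le
  have t4 : Q.card * (CE * L) ≤ ∑ e ∈ Q, CE * dist e.1 e.2 := by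
    rw [← nsmul_eq_mul]
    apply Finset.card_nsmul_le_sum
    intro e he
    have he := (Finset.mem_filter.1 he).1
    rw [hHe] at he
    exact mul_le_mul_of_nonneg_left (len_ge hL he) hCE.le
  have t2 : 0 ≤ ∑ e ∈ G.edges.filter (fun e => mEdge H.toEGraph m.f e ≠ none),
      CE * |dist e.1 e.2 - elen (mEdge H.toEGraph m.f e)| :=
    Finset.sum_nonneg fun _ _ => by positivity
  have ho : ∀ a b : Option (Pt 2), 0 ≤ odist a b := by
    intro a b
    rcases a with _ | a <;> rcases b with _ | b <;> simp [odist, dist_nonneg]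
  have h1 : ∀ u ∈ G.verts.filter (fun u => m.f u ≠ none), 0 ≤ CV * odist (some u) (m.f u) :=
    fun u _ => mul_nonneg hCV.le (ho (some u) (m.f u))
  have hCL : 0 < CE * L := by positivity
  unfold matchCost
  rw [← hP, ← hQ]
  by_cases hex : ∃ u ∈ G.verts, m.f u ≠ none
  · obtain ⟨u, hu, hn⟩ := hex
    have t1 := Finset.single_le_sum h1 (Finset.mem_filter.2 ⟨hu, hn⟩)
    obtain ⟨v, hv⟩ := Option.ne_none_iff_exists'.1 hn
    have hvH := m.f_mem u hu v hv
    have t1' : CV * δ ≤ CV * odist (some u) (m.f u) := by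
      apply mul_le_mul_of_nonneg_left _ hCV.le
      rw [hv]
      rw [hGv] at hu
      rw [hHv] at hvH
      simp only [Finset.mem_biUnion, Finset.mem_univ, true_and, mem_blobVerts'] at hu hvH
      obtain ⟨i, j, h, hj, rfl, -⟩ := hu
      obtain ⟨i', j', h', hj', rfl, -⟩ := hvH
      simp only [odist, dist_pt2]
      have q1 : (j : ℝ) * s ≤ a i * s := by gcongr
      have q4 : 0 ≤ (j' : ℝ) * s := by positivity
      have q5 := hδ i i'
      refine le_trans ?_ (Real.sqrt_le_sqrt (le_add_of_nonneg_right (sq_nonneg _)))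
      rw [Real.sqrt_sq_eq_abs]
      refine le_trans ?_ (neg_le_abs _)
      linarith
    have := min_le_left (CV * δ) (CE * L)
    nlinarith
  · push Not at hex
    have t1 := Finset.sum_nonneg h1
    have hPG : P = G.edges := by
      apply Finset.filter_true_of_mem
      intro e he
      unfold mEdge
      rw [hex _ (G.edge_fst_mem e he)]
    rw [hPG] at t3 hP1 hPQ
    rw [hPG]
    have := min_le_right (CV * δ) (CE * L)
    have hN' : (2 : ℝ) ≤ N := by exact_mod_cast hN
    have hB' : (3 : ℝ) ≤ B := by exact_mod_cast hB
    have hbig : (2 : ℝ) ≤ G.edges.card := by rw [hGc]; nlinarith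
    nlinarith

/-- hardness reduction from 3-PARTITION.  Let `N > 1`, `B > 0`, let
`a_1, …, a_{3N}` be positive integers with `B/4 < a_i < B/2` and `Σ a_i = N·B`, and let
`τ > 0`.  Let `G` consist of `3N` pairwise disjoint blobs of sizes `a_1, …, a_{3N}` and `H`
of `N` pairwise disjoint blobs of size `B`, placed side-by-side (the blobs of `G` to the left
of those of `H`, in a common bounding box of width `x = τ/(2·C_V·(N+1)·N·B)` and height
`L = τ/(2·C_E·(N+1))`, with a common spacing `s > 0` so that all vertical and all slanted
edges have equal lengths).  Then `S` admits a partition into `N` triples each summing to `B`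
iff `GGD(G,H) ≤ τ`. -/
theorem threePartition_iff_ggd_le (CV CE τ : ℝ) (hCV : 0 < CV) (hCE : 0 < CE) (hτ : 0 < τ)
    (N B : ℕ) (hN : 1 < N) (hB : 0 < B)
    (a : Fin (3 * N) → ℕ)
    (ha₁ : ∀ i, (B : ℝ) / 4 < (a i : ℝ)) (ha₂ : ∀ i, (a i : ℝ) < (B : ℝ) / 2)
    (hsum : ∑ i, a i = N * B)
    (x L : ℝ)
    (hx : x = τ / (2 * CV * (N + 1) * N * B))
    (hL : L = τ / (2 * CE * (N + 1)))
    (s : ℝ) (hs : 0 < s)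
    (cG : Fin (3 * N) → ℝ) (cH : Fin N → ℝ)
    (hG0 : ∀ i, 0 ≤ cG i)
    (hGsep : ∀ i j, i < j → cG i + (a i : ℝ) * s < cG j)
    (hGH : ∀ i j, cG i + (a i : ℝ) * s < cH j)
    (hHsep : ∀ i j, i < j → cH i + (B : ℝ) * s < cH j)
    (hHbox : ∀ j, cH j + (B : ℝ) * s ≤ x)
    (G H : GeoGraph 2)
    (hGv : G.verts = Finset.univ.biUnion fun i : Fin (3 * N) => blobVerts L (cG i) s (a i))
    (hGe : G.edges = Finset.univ.biUnion fun i : Fin (3 * N) => blobEdges L (cG i) s (a i))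
    (hHv : H.verts = Finset.univ.biUnion fun j : Fin N => blobVerts L (cH j) s B)
    (hHe : H.edges = Finset.univ.biUnion fun j : Fin N => blobEdges L (cH j) s B) :
    (∃ f : Fin (3 * N) → Fin N,
        (∀ t, (Finset.univ.filter fun i => f i = t).card = 3) ∧
        (∀ t, ∑ i ∈ Finset.univ.filter (fun i => f i = t), a i = B)) ↔
      GGD CV CE G H ≤ τ := by
  have hBr : (0 : ℝ) < B := by exact_mod_cast hB
  have hNr : (0 : ℝ) < N := by exact_mod_cast (by omega : 0 < N)
  have hn1 : ∀ i, B + 1 ≤ 4 * a i := by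
    intro i
    have h := ha₁ i
    have : (B : ℝ) < 4 * a i := by linarith
    have : B < 4 * a i := by exact_mod_cast this
    omega
  have hn2 : ∀ i, 2 * a i + 1 ≤ B := by
    intro i
    have h := ha₂ i
    have : 2 * (a i : ℝ) < B := by linarith
    have : 2 * a i < B := by exact_mod_cast this
    omega
  have ha : ∀ i, 1 ≤ a i := fun i => by have := hn1 i; omega
  have hB3 : 3 ≤ B := by
    have i : Fin (3 * N) := ⟨0, by omega⟩
    have := hn2 i; have := ha i; omega
  have hLpos : 0 < L := by rw [hL]; positivity
  have hxpos : 0 < x := by rw [hx]; positivity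
  have hτL : CE * L * (2 * N + 2) = τ := by rw [hL]; field_simp
  have hxL : 2 * N * B * CV * x + CE * (2 * N * L) = τ := by
    rw [hL, hx]; field_simp; ring
  have hbdd : BddBelow {c : ℝ | ∃ m : Matching 2 G.toEGraph H.toEGraph, matchCost CV CE m = c} := by
    refine ⟨0, ?_⟩
    rintro c ⟨m, rfl⟩
    exact matchCost_nonneg hCV hCE m
  constructor
  · rintro ⟨f, -, hf⟩
    obtain ⟨m, hm⟩ := forward (CE := CE) hCV hB ha hsum hLpos hxpos.le hs hG0 hGsep hGH hHsep
      hHbox hGv hGe hHv hHe f hf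
    rw [hxL] at hm
    exact (csInf_le hbdd ⟨m, rfl⟩).trans hm
  · intro hle
    by_contra hno
    obtain ⟨δ, hδ0, hδ⟩ : ∃ δ > 0, ∀ i j, δ ≤ cH j - (cG i + (a i : ℝ) * s) := by
      haveI : Nonempty (Fin (3 * N) × Fin N) := ⟨(⟨0, by omega⟩, ⟨0, by omega⟩)⟩
      obtain ⟨p, hp⟩ := Finite.exists_min
        (fun p : Fin (3 * N) × Fin N => cH p.2 - (cG p.1 + (a p.1 : ℝ) * s))
      exact ⟨_, sub_pos.2 (hGH p.1 p.2), fun i j => hp (i, j)⟩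
    have hγ : 0 < min (CV * δ) (CE * L) := lt_min (by positivity) (by positivity)
    have : τ + min (CV * δ) (CE * L) ≤ GGD CV CE G H := by
      apply le_csInf
      · exact ⟨_, ⟨fun _ => none, fun _ => none, by simp, by simp, by simp⟩, rfl⟩
      · rintro c ⟨m, rfl⟩
        refine gap hCV hCE hN hB3 ha hsum hLpos hτL hs hGsep hHsep hGv hGe hHv hHe hδ m ?_
        intro hall
        obtain ⟨f, hf⟩ := backward hsum hs ha hGsep hHsep hGe hHe m hall
        exact hno ⟨f, fun t => triple_card hB hn1 hn2 _ (hf t), hf⟩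
    linarith
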